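/- Let n be a natural number and let R be the commutative ring of entire functions on ℂⁿ. Let I be an ideal of R stable under every partial derivative ∂/∂z_j. Let x ∈ ℂⁿ and let μ ≥ 1 be a natural number, and suppose some f ∈ I vanishes to order exactly μ at x (iteratedFDeriv ℂ k f x = 0 for all k < μ and iteratedFDeriv ℂ μ f x ≠ 0). Then some g ∈ I vanishes to order exactly μ − 1 at x: iteratedFDeriv ℂ k g x = 0 for all k < μ − 1 and iteratedFDeriv ℂ (μ − 1) g x ≠ 0. -/

import Mathlib

/-- The commutative ring of entire functions on `ℂⁿ` (realized as `Fin n → ℂ`),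
as a subalgebra of all functions `(Fin n → ℂ) → ℂ` with pointwise operations. -/
def Entire (n : ℕ) : Subalgebra ℂ ((Fin n → ℂ) → ℂ) where
  carrier := {f | Differentiable ℂ f}
  mul_mem' hf hg := hf.mul hg
  add_mem' hf hg := hf.add hg
  algebraMap_mem' c := differentiable_const c

section SeveralVariables

open Metric Set MeasureTheory

variable {E : Type*} [NormedAddCommGroup E] [NormedSpace ℂ E]

theorem hasDerivAt_comp_line {f : E → ℂ} (hf : Differentiable ℂ f) (y v : E) :
    HasDerivAt (fun t : ℂ => f (y + t • v)) (fderiv ℂ f y v) 0 := by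
  have hline : HasDerivAt (fun t : ℂ => y + t • v) v 0 := by
    simpa using ((hasDerivAt_id (0 : ℂ)).smul_const v).const_add y
  have hfy : HasFDerivAt f (fderiv ℂ f y) (y + (0 : ℂ) • v) := by
    simpa using (hf y).hasFDerivAt
  exact hfy.comp_hasDerivAt (0 : ℂ) hline

theorem differentiable_comp_line {f : E → ℂ} (hf : Differentiable ℂ f) (y v : E) :
    Differentiable ℂ (fun t : ℂ => f (y + t • v)) := by
  fun_prop

/-- **Cauchy's estimate** for the Fréchet derivative of an entire function. -/
theorem norm_fderiv_le_of_forall_mem_closedBall {f : E → ℂ} (hf : Differentiable ℂ f) {y : E}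
    {M : ℝ} (hM : ∀ z ∈ closedBall y 1, ‖f z‖ ≤ M) : ‖fderiv ℂ f y‖ ≤ M := by
  have hM0 : 0 ≤ M := (norm_nonneg _).trans (hM y (mem_closedBall_self zero_le_one))
  refine ContinuousLinearMap.opNorm_le_bound _ hM0 fun v => ?_
  rcases eq_or_ne v 0 with rfl | hv
  · simp
  have hv' : 0 < ‖v‖ := norm_pos_iff.2 hv
  have key := Complex.norm_deriv_le_of_forall_mem_sphere_norm_le (c := 0) (C := M)
    (inv_pos.2 hv') (differentiable_comp_line hf y v).diffContOnCl fun t ht => by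
      refine hM _ ?_
      rw [mem_sphere_zero_iff_norm] at ht
      simp [norm_smul, ht, hv'.ne']
  rwa [(hasDerivAt_comp_line hf y v).deriv, div_inv_eq_mul] at key

theorem fderiv_apply_eq_circleIntegral {f : E → ℂ} (hf : Differentiable ℂ f) (y v : E) :
    fderiv ℂ f y v =
      (2 * Real.pi * Complex.I)⁻¹ • ∮ t in C(0, 1), (t ^ 2)⁻¹ • f (y + t • v) := by
  have key := Complex.two_pi_I_inv_smul_circleIntegral_sub_sq_inv_smul_of_differentiable
    isOpen_univ (subset_univ (closedBall (0 : ℂ) 1))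
    (differentiable_comp_line hf y v).differentiableOn (mem_ball_self one_pos)
  simp only [sub_zero] at key
  rw [key, (hasDerivAt_comp_line hf y v).deriv]

variable [FiniteDimensional ℂ E]

/-- A directional derivative of an entire function is entire. -/
theorem differentiable_fderiv_apply {f : E → ℂ} (hf : Differentiable ℂ f) (v : E) :
    Differentiable ℂ fun z => fderiv ℂ f z v := by
  have : ProperSpace E := FiniteDimensional.proper ℂ E
  have : ProperSpace (E →L[ℂ] ℂ) := FiniteDimensional.proper ℂ _
  let : MeasurableSpace E := borel E
  have : BorelSpace E := ⟨rfl⟩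
  let : MeasurableSpace (E →L[ℂ] ℂ) := borel _
  have : BorelSpace (E →L[ℂ] ℂ) := ⟨rfl⟩
  simp_rw [fderiv_apply_eq_circleIntegral hf _ v]
  intro x
  refine DifferentiableAt.fun_const_smul (R := ℂ) ?_ _
  obtain ⟨M, hM⟩ := (isCompact_closedBall x (2 + ‖v‖)).exists_bound_of_continuousOn
    hf.continuous.continuousOn
  let c : ℝ → ℂ := fun θ => deriv (circleMap 0 1) θ * (circleMap 0 1 θ ^ 2)⁻¹
  have hc : Continuous c := by
    have h0 : ∀ θ, circleMap 0 1 θ ^ 2 ≠ 0 := fun θ =>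
      pow_ne_zero _ (circleMap_ne_center one_ne_zero)
    simp only [c, deriv_circleMap]
    fun_prop (disch := exact h0 _)
  have hc1 : ∀ θ, ‖c θ‖ = 1 := fun θ => by simp [c]
  have hp : ∀ y : E, Continuous fun θ : ℝ => y + circleMap 0 1 θ • v := fun y => by fun_prop
  have hF : ∀ y : E, Continuous fun θ : ℝ => c θ • f (y + circleMap 0 1 θ • v) :=
    fun y => hc.smul (hf.continuous.comp (hp y))
  have hint := intervalIntegral.hasFDerivAt_integral_of_dominated_of_fderiv_le
    (𝕜 := ℂ) (μ := volume) (a := 0) (b := 2 * Real.pi) (x₀ := x) (bound := fun _ => M)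
    (F := fun y θ => c θ • f (y + circleMap 0 1 θ • v))
    (F' := fun y θ => c θ • fderiv ℂ f (y + circleMap 0 1 θ • v))
    (ball_mem_nhds x one_pos)
    (.of_forall fun y => (hF y).aestronglyMeasurable)
    ((hF x).intervalIntegrable _ _)
    (hc.aestronglyMeasurable.smul
      ((measurable_fderiv ℂ f).comp (hp x).measurable).aestronglyMeasurable)
    (.of_forall fun θ _ y hy => ?_)
    intervalIntegrable_const
    (.of_forall fun θ _ y _ => ?_)
  · convert hint.differentiableAt using 2 with y
    simp only [circleIntegral, c, smul_eq_mul, mul_assoc]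
  · rw [norm_smul, hc1, one_mul]
    refine norm_fderiv_le_of_forall_mem_closedBall hf fun z hz => hM z ?_
    rw [mem_closedBall] at hz ⊢
    rw [mem_ball] at hy
    have hv : dist (y + circleMap 0 1 θ • v) y = ‖v‖ := by
      simp [dist_eq_norm, norm_smul]
    linarith [dist_triangle z (y + circleMap 0 1 θ • v) x,
      dist_triangle (y + circleMap 0 1 θ • v) y x]
  · exact (((hf _).hasFDerivAt.comp y ((hasFDerivAt_id y).add_const _)).const_smul (c θ))

/-- An entire function of several complex variables is smooth. -/
theorem contDiff_of_differentiable {f : E → ℂ} (hf : Differentiable ℂ f) (k : ℕ) :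
    ContDiff ℂ k f := by
  induction k generalizing f with
  | zero => exact contDiff_zero.2 hf.continuous
  | succ k ih =>
    exact contDiff_succ_iff_fderiv_apply.2
      ⟨hf, by simp, fun v => ih (differentiable_fderiv_apply hf v)⟩

theorem iteratedFDeriv_fderiv_apply {f : E → ℂ} (hf : Differentiable ℂ f) (k : ℕ) (x v : E)
    (w : Fin k → E) :
    iteratedFDeriv ℂ k (fun z => fderiv ℂ f z v) x w =
      iteratedFDeriv ℂ (k + 1) f x (Fin.snoc w v) := by
  have hf' : ContDiffAt ℂ k (fderiv ℂ f) x :=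
    ((contDiff_of_differentiable hf (k + 1)).fderiv_right (by norm_cast)).contDiffAt
  have h := (ContinuousLinearMap.apply ℂ ℂ v).iteratedFDeriv_comp_left hf' le_rfl
  rw [iteratedFDeriv_succ_apply_right, Fin.init_snoc, Fin.snoc_last]
  exact congrArg (fun A => A w) h

end SeveralVariables

/-- Let `I` be an ideal of the ring of entire functions on `ℂⁿ` stable under all
partial derivatives `∂/∂z_j`.  If some `f ∈ I` vanishes to order exactly `μ ≥ 1` at `x`, then
some `g ∈ I` vanishes to order exactly `μ - 1` at `x`. -/
theorem pderiv_stable_ideal_order_decrease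
    (n : ℕ) (I : Ideal (Entire n))
    (hstab : ∀ f ∈ I, ∀ j : Fin n,
      ∀ g : Entire n,
        (∀ z : Fin n → ℂ, (g : (Fin n → ℂ) → ℂ) z
            = fderiv ℂ (f : (Fin n → ℂ) → ℂ) z (Pi.single j 1)) →
        g ∈ I)
    (x : Fin n → ℂ) (μ : ℕ) (hμ : 1 ≤ μ)
    (hf : ∃ f ∈ I,
      (∀ k < μ, iteratedFDeriv ℂ k (f : (Fin n → ℂ) → ℂ) x = 0) ∧
      iteratedFDeriv ℂ μ (f : (Fin n → ℂ) → ℂ) x ≠ 0) :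
    ∃ g ∈ I,
      (∀ k < μ - 1, iteratedFDeriv ℂ k (g : (Fin n → ℂ) → ℂ) x = 0) ∧
      iteratedFDeriv ℂ (μ - 1) (g : (Fin n → ℂ) → ℂ) x ≠ 0 := by
  obtain ⟨f, hfI, hvan, hne⟩ := hf
  obtain ⟨m, rfl⟩ : ∃ m, μ = m + 1 := ⟨μ - 1, by omega⟩
  rw [Nat.add_sub_cancel]
  have hfd : Differentiable ℂ (f : (Fin n → ℂ) → ℂ) := f.2
  let g (j : Fin n) : Entire n :=
    ⟨fun z => fderiv ℂ (f : (Fin n → ℂ) → ℂ) z (Pi.single j 1),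
      differentiable_fderiv_apply hfd _⟩
  have hg : ∀ j k w, iteratedFDeriv ℂ k (g j : (Fin n → ℂ) → ℂ) x w =
      iteratedFDeriv ℂ (k + 1) (f : (Fin n → ℂ) → ℂ) x (Fin.snoc w (Pi.single j 1)) :=
    fun j k w => iteratedFDeriv_fderiv_apply hfd k x _ w
  obtain ⟨j, hj⟩ : ∃ j, iteratedFDeriv ℂ m (g j : (Fin n → ℂ) → ℂ) x ≠ 0 := by
    by_contra! h0
    refine hne (ContinuousMultilinearMap.ext fun w => ?_)
    rw [iteratedFDeriv_succ_apply_right]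
    have hzero : iteratedFDeriv ℂ m (fderiv ℂ (f : (Fin n → ℂ) → ℂ)) x (Fin.init w) = 0 := by
      refine ContinuousLinearMap.coe_injective ((Pi.basisFun ℂ (Fin n)).ext fun j => ?_)
      have h := hg j m (Fin.init w)
      rw [h0 j, iteratedFDeriv_succ_apply_right, Fin.init_snoc, Fin.snoc_last] at h
      simpa using h.symm
    simp [hzero]
  refine ⟨g j, hstab f hfI j (g j) fun _ => rfl, fun k hk => ?_, hj⟩
  ext w
  rw [hg, hvan (k + 1) (by omega)]
  rfl
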